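/- arXiv:1809.10664 — 4 statements merged into one kernel-verified Lean document; each statement's English description precedes it below -/
import Mathlib

section
/- For every n ≥ 1 and every t : ℕ → ℤ with t(k) ∈ {−1, 0, +1} for all k, the characteristic height of M_n(t) is at most the characteristic height of M_n(t₋), where t₋(k) = −1 for all k. That is, the choice t(k) = −1 for all k maximizes the characteristic height over all such t. -/
open Polynomial Matrix Finset

/-- The `n × n` upper Hessenberg Toeplitz matrix with entries `t (j - i + 1)` on and above
the diagonal (1-based indexing), `1` on the subdiagonal, and `0` below. -/
def uht (t : ℕ → ℤ) (n : ℕ) : Matrix (Fin n) (Fin n) ℤ :=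
  Matrix.of fun i j =>
    if (i : ℕ) ≤ (j : ℕ) then t ((j : ℕ) - (i : ℕ) + 1)
    else if (i : ℕ) = (j : ℕ) + 1 then 1 else 0

/-- The height of an integer polynomial: the maximum of the absolute values of
its coefficients. -/
def heightZ (p : Polynomial ℤ) : ℕ :=
  p.support.sup fun k => (p.coeff k).natAbs

/-- The polynomial `q` bounds `p` coefficientwise in absolute value. -/
def CoeffDominated (p q : ℤ[X]) : Prop :=
  ∀ k, |p.coeff k| ≤ q.coeff k

lemma CoeffDominated.add {p q p' q' : ℤ[X]} (h : CoeffDominated p q)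
    (h' : CoeffDominated p' q') : CoeffDominated (p + p') (q + q') := fun k => by
  simpa only [coeff_add] using (abs_add_le _ _).trans (add_le_add (h k) (h' k))

lemma CoeffDominated.mul {p q p' q' : ℤ[X]} (h : CoeffDominated p q)
    (h' : CoeffDominated p' q') : CoeffDominated (p * p') (q * q') := fun k => by
  rw [coeff_mul, coeff_mul]
  refine (Finset.abs_sum_le_sum_abs _ _).trans (Finset.sum_le_sum fun x _ => ?_)
  rw [abs_mul]
  exact mul_le_mul (h _) (h' _) (abs_nonneg _) ((abs_nonneg _).trans (h _))

lemma CoeffDominated.one : CoeffDominated 1 1 := fun k => by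
  rw [coeff_one]
  split_ifs <;> simp

lemma heightZ_le_of_coeffDominated {p q : ℤ[X]} (h : CoeffDominated p q) :
    heightZ p ≤ heightZ q := by
  refine Finset.sup_le fun k hk => ?_
  have hk' := abs_le.mp (h k)
  have hp := mem_support_iff.mp hk
  have hq : k ∈ q.support := mem_support_iff.mpr (by grind)
  exact le_trans (by omega) (Finset.le_sup (f := fun k => (q.coeff k).natAbs) hq)

/-- The upper Hessenberg Toeplitz matrix with entries `a (j - i)` on and above the diagonal
and `-1` on the subdiagonal. -/
def hessenbergToeplitz {R : Type*} [Ring R] (a : ℕ → R) (n : ℕ) : Matrix (Fin n) (Fin n) R :=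
  Matrix.of fun i j =>
    if (i : ℕ) ≤ (j : ℕ) then a ((j : ℕ) - (i : ℕ))
    else if (i : ℕ) = (j : ℕ) + 1 then -1 else 0

/-- The matrix `hessenbergToeplitz a (n + 1)` with its first row replaced by `r`. -/
def firstRowHessenbergToeplitz {R : Type*} [Ring R] (r a : ℕ → R) (n : ℕ) :
    Matrix (Fin (n + 1)) (Fin (n + 1)) R :=
  (hessenbergToeplitz a (n + 1)).updateRow 0 fun j => r j

lemma firstRowHessenbergToeplitz_self {R : Type*} [Ring R] (a : ℕ → R) (n : ℕ) :
    firstRowHessenbergToeplitz a a n = hessenbergToeplitz a (n + 1) := by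
  ext i j
  refine Fin.cases ?_ (fun i => ?_) i <;>
    simp [firstRowHessenbergToeplitz, hessenbergToeplitz, updateRow_apply]

lemma det_firstRowHessenbergToeplitz_zero {R : Type*} [CommRing R] (r a : ℕ → R) :
    (firstRowHessenbergToeplitz r a 0).det = r 0 := by
  simp [firstRowHessenbergToeplitz]

lemma det_firstRowHessenbergToeplitz_succ {R : Type*} [CommRing R] (r a : ℕ → R) (n : ℕ) :
    (firstRowHessenbergToeplitz r a (n + 1)).det =
      r 0 * (hessenbergToeplitz a (n + 1)).det +
        (firstRowHessenbergToeplitz (fun k => r (k + 1)) a n).det := by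
  have h₀ : (firstRowHessenbergToeplitz r a (n + 1)).submatrix (Fin.succAbove 0) Fin.succ =
      hessenbergToeplitz a (n + 1) := by
    ext i j
    simp [firstRowHessenbergToeplitz, hessenbergToeplitz, updateRow_apply]
  have h₁ : (firstRowHessenbergToeplitz r a (n + 1)).submatrix
      (Fin.succAbove (Fin.succ 0)) Fin.succ =
      firstRowHessenbergToeplitz (fun k => r (k + 1)) a n := by
    ext i j
    refine Fin.cases ?_ (fun i => ?_) i <;>
      simp [firstRowHessenbergToeplitz, hessenbergToeplitz, updateRow_apply]
  rw [det_succ_column_zero, Fin.sum_univ_succ, Fin.sum_univ_succ, h₀, h₁,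
    Finset.sum_eq_zero]
  · simp [firstRowHessenbergToeplitz, hessenbergToeplitz, updateRow_apply]
  · intro i _
    simp [firstRowHessenbergToeplitz, hessenbergToeplitz, updateRow_apply]

lemma det_firstRowHessenbergToeplitz_coeffDominated {a b : ℕ → ℤ[X]} {n : ℕ}
    (hdet : ∀ m ≤ n, CoeffDominated (hessenbergToeplitz a m).det (hessenbergToeplitz b m).det)
    {r s : ℕ → ℤ[X]} (hrs : ∀ k, CoeffDominated (r k) (s k)) :
    CoeffDominated (firstRowHessenbergToeplitz r a n).det
      (firstRowHessenbergToeplitz s b n).det := by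
  induction n generalizing r s with
  | zero => simpa only [det_firstRowHessenbergToeplitz_zero] using hrs 0
  | succ n ih =>
    rw [det_firstRowHessenbergToeplitz_succ, det_firstRowHessenbergToeplitz_succ]
    exact ((hrs 0).mul (hdet _ le_rfl)).add
      (ih (fun m hm => hdet m (hm.trans n.le_succ)) fun k => hrs (k + 1))

lemma det_hessenbergToeplitz_coeffDominated {a b : ℕ → ℤ[X]}
    (hab : ∀ k, CoeffDominated (a k) (b k)) (n : ℕ) :
    CoeffDominated (hessenbergToeplitz a n).det (hessenbergToeplitz b n).det := by
  induction n using Nat.strong_induction_on with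
  | _ n ih =>
    rcases n with _ | n
    · simpa only [det_fin_zero] using CoeffDominated.one
    · rw [← firstRowHessenbergToeplitz_self, ← firstRowHessenbergToeplitz_self]
      exact det_firstRowHessenbergToeplitz_coeffDominated
        (fun m hm => ih m (Nat.lt_succ_of_le hm)) hab

lemma charmatrix_uht (t : ℕ → ℤ) (n : ℕ) :
    charmatrix (uht t n) =
      hessenbergToeplitz (fun k => (if k = 0 then X else 0) - C (t (k + 1))) n := by
  ext1 i j
  rw [charmatrix_apply, diagonal_apply]
  simp only [uht, hessenbergToeplitz, of_apply, Fin.ext_iff]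
  split_ifs <;> first | omega | simp

theorem uht_maximal_characteristic_height (n : ℕ) (hn : 1 ≤ n)
    (t : ℕ → ℤ) (ht : ∀ k, t k ∈ ({-1, 0, 1} : Set ℤ)) :
    heightZ (uht t n).charpoly ≤ heightZ (uht (fun _ => -1) n).charpoly := by
  refine heightZ_le_of_coeffDominated ?_
  rw [Matrix.charpoly, Matrix.charpoly, charmatrix_uht, charmatrix_uht]
  refine det_hessenbergToeplitz_coeffDominated (fun k m => ?_) n
  have hbound : |t (k + 1)| ≤ 1 := by
    obtain h | h | h : t (k + 1) = -1 ∨ t (k + 1) = 0 ∨ t (k + 1) = 1 := ht (k + 1)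
    all_goals simp [h]
  rw [abs_le] at hbound
  simp only [coeff_sub, coeff_C, apply_ite (coeff · m), coeff_X, coeff_zero, abs_le]
  split_ifs <;> omega
end

section
/- Fix n ≥ 1 and suppose t : ℕ → ℤ with values in {−1,0,+1} is such that M_n(t) attains the maximal characteristic height τ over all such choices, and let μ be an index with |p_{n,μ}| = τ, where p_{n,k} are the coefficients of the characteristic polynomial of M_n(t). Then for every t' : ℕ → ℤ with values in {−1,0,+1} satisfying t'(j) = t(j) for all 1 ≤ j ≤ n−μ, the characteristic height of M_n(t') also equals τ. -/
open Polynomial Matrix Finset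

/-- Deleting the first row and column of `uht t (n + 1)` gives `uht t n`. -/
theorem charmatrix_uht_succ_succ (t : ℕ → ℤ) (n : ℕ) (i j : Fin n) :
    (uht t (n + 1)).charmatrix i.succ j.succ = (uht t n).charmatrix i j := by
  simp [charmatrix_apply, uht, Matrix.diagonal_apply]

/-- Expansion of the characteristic determinant of `uht t (n + 1)` with its first row replaced
by an arbitrary row `v`. -/
theorem det_updateRow_charmatrix_uht (t : ℕ → ℤ) (n : ℕ) (v : ℕ → ℤ[X]) :
    ((uht t (n + 1)).charmatrix.updateRow 0 fun j => v j).det =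
      ∑ k ∈ range (n + 1), v k * (uht t (n - k)).charpoly := by
  induction n generalizing v with
  | zero => simp [charpoly]
  | succ n ih =>
    have hminor₀ : ((uht t (n + 2)).charmatrix.updateRow 0 fun j => v j).submatrix
        (Fin.succAbove 0) Fin.succ = (uht t (n + 1)).charmatrix := by
      ext1 i j
      simp [charmatrix_uht_succ_succ]
    have hminor₁ : ((uht t (n + 2)).charmatrix.updateRow 0 fun j => v j).submatrix
        (Fin.succAbove 1) Fin.succ =
          (uht t (n + 1)).charmatrix.updateRow 0 fun j => v (j + 1) := by
      ext1 i j
      refine Fin.cases ?_ (fun i => ?_) i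
      · simp
      · have h : (1 : Fin (n + 2)).succAbove i.succ = i.succ.succ :=
          Fin.succ_succAbove_succ 0 i
        rw [submatrix_apply, h, updateRow_ne (Fin.succ_ne_zero _),
          updateRow_ne (Fin.succ_ne_zero _), charmatrix_uht_succ_succ]
    have hentry₁ : uht t (n + 2) 1 0 = 1 := by
      simp [uht]
    have hentry (i : Fin n) : uht t (n + 2) i.succ.succ 0 = 0 := by
      simp [uht]
    have hsize (k : ℕ) : (uht t (n + 1 - (k + 1))).charpoly = (uht t (n - k)).charpoly := by
      rw [Nat.add_sub_add_right]
    rw [det_succ_column_zero, Fin.sum_univ_succ, Fin.sum_univ_succ, Fin.succ_zero_eq_one,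
      hminor₀, hminor₁, ih fun j => v (j + 1), sum_range_succ' _ (n + 1)]
    simp only [hsize]
    simp [hentry, hentry₁, charpoly, add_comm (v 0 * _)]

theorem charpoly_uht_succ (t : ℕ → ℤ) (n : ℕ) :
    (uht t (n + 1)).charpoly =
      X * (uht t n).charpoly -
        ∑ k ∈ range (n + 1), C (t (k + 1)) * (uht t (n - k)).charpoly := by
  have hrow : (uht t (n + 1)).charmatrix = (uht t (n + 1)).charmatrix.updateRow 0
      fun j => (if (j : ℕ) = 0 then X else 0) - C (t (j + 1)) := by
    conv_lhs => rw [← updateRow_eq_self (uht t (n + 1)).charmatrix 0]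
    congr 1
    ext1 j
    refine Fin.cases ?_ (fun j => ?_) j <;> simp [uht, (Fin.succ_ne_zero _).symm]
  rw [charpoly, hrow,
    det_updateRow_charmatrix_uht t n fun j => (if j = 0 then X else 0) - C (t (j + 1))]
  simp [sub_mul, sum_sub_distrib]

/-- The coefficient of `X ^ k` in the characteristic polynomial of `uht t n` depends only on
`t 1, …, t (n - k)`. -/
theorem coeff_charpoly_uht_congr {t t' : ℕ → ℤ} {n k : ℕ}
    (h : ∀ j, 1 ≤ j → j ≤ n - k → t' j = t j) :
    (uht t' n).charpoly.coeff k = (uht t n).charpoly.coeff k := by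
  induction n using Nat.strong_induction_on generalizing k with
  | _ n ih =>
    cases n with
    | zero => simp [charpoly]
    | succ n =>
      rw [charpoly_uht_succ, charpoly_uht_succ, coeff_sub, coeff_sub, finsetSum_coeff,
        finsetSum_coeff]
      congr 1
      · cases k with
        | zero => simp
        | succ k =>
          rw [coeff_X_mul, coeff_X_mul]
          exact ih n (by lia) fun j hj hjn => h j hj (by lia)
      · refine sum_congr rfl fun j hj => ?_
        rw [mem_range] at hj
        rw [coeff_C_mul, coeff_C_mul, ih (n - j) (by lia) fun i hi hin => h i hi (by lia)]
        by_cases hjk : j + 1 ≤ n + 1 - k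
        · rw [h _ (by lia) hjk]
        · rw [coeff_eq_zero_of_natDegree_lt (p := (uht t (n - j)).charpoly)
            (by rw [charpoly_natDegree_eq_dim, Fintype.card_fin]; lia), mul_zero, mul_zero]

theorem natAbs_coeff_le_heightZ (p : ℤ[X]) (k : ℕ) : (p.coeff k).natAbs ≤ heightZ p := by
  by_cases hk : k ∈ p.support
  · exact le_sup (f := fun k => (p.coeff k).natAbs) hk
  · simp [notMem_support_iff.mp hk]

theorem uht_tail_entries_preserve_maximal_height (n : ℕ) (hn : 1 ≤ n)
    (t : ℕ → ℤ) (ht : ∀ k, t k ∈ ({-1, 0, 1} : Set ℤ))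
    (τ : ℕ) (hτ : τ = heightZ (uht t n).charpoly)
    (hmax : ∀ t' : ℕ → ℤ, (∀ k, t' k ∈ ({-1, 0, 1} : Set ℤ)) →
      heightZ (uht t' n).charpoly ≤ τ)
    (μ : ℕ) (hμ : (((uht t n).charpoly).coeff μ).natAbs = τ)
    (t' : ℕ → ℤ) (ht' : ∀ k, t' k ∈ ({-1, 0, 1} : Set ℤ))
    (hagree : ∀ j : ℕ, 1 ≤ j → j ≤ n - μ → t' j = t j) :
    heightZ (uht t' n).charpoly = τ := by
  refine le_antisymm (hmax t' ht') ?_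
  rw [← hμ, ← coeff_charpoly_uht_congr hagree]
  exact natAbs_coeff_le_heightZ _ _
end

section
/- Let M̃_n = M_n(t₋) where t₋(k) = −1 for all k, and let p_{n,k} denote the coefficient of z^k in the characteristic polynomial of M̃_n. Then for every i ≥ 0, the generating function of the sequence (p_{i,i}, p_{i+1,i}, p_{i+2,i}, …) is ((1−x)/(1−2x))^{i+1}; equivalently, in the ring of formal power series ℤ⟦X⟧, (1−2X)^{i+1} · Σ_{ℓ=0}^{∞} p_{i+ℓ,i} X^ℓ = (1−X)^{i+1}. -/
open Polynomial Matrix Finset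

lemma uht_apply (t : ℕ → ℤ) (n : ℕ) (i j : Fin n) :
    uht t n i j = if (i : ℕ) ≤ (j : ℕ) then t ((j : ℕ) - (i : ℕ) + 1)
      else if (i : ℕ) = (j : ℕ) + 1 then 1 else 0 :=
  rfl

/-- The entries of the characteristic matrix of `uht (fun _ => -1) n`. -/
lemma charmatrix_uht_neg_one_apply (n : ℕ) (i j : Fin n) :
    (uht (fun _ => -1) n).charmatrix i j =
      if (i : ℕ) = j then (X + 1 : ℤ[X])
      else if (i : ℕ) < j then 1 else if (i : ℕ) = j + 1 then -1 else 0 := by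
  rw [Matrix.charmatrix_apply, Matrix.diagonal_apply]
  simp only [uht, Matrix.of_apply, Fin.ext_iff]
  split_ifs <;> first | omega | simp

lemma charmatrix_uht_neg_one_submatrix_succ (n : ℕ) :
    (uht (fun _ => -1) (n + 1)).charmatrix.submatrix Fin.succ Fin.succ =
      (uht (fun _ => -1) n).charmatrix := by
  ext1 i j
  simp [charmatrix_uht_neg_one_apply]

/-- Deleting the first row and the second column leaves a matrix whose determinant is read off
from its first column. -/
lemma det_charmatrix_uht_neg_one_submatrix_succAbove_one (n : ℕ) :
    ((uht (fun _ => -1) (n + 2)).charmatrix.submatrix Fin.succ (Fin.succAbove 1)).det =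
      -(uht (fun _ => -1) n).charpoly := by
  have hsub : ((uht (fun _ => -1) (n + 2)).charmatrix.submatrix Fin.succ
      (Fin.succAbove 1)).submatrix Fin.succ Fin.succ = (uht (fun _ => -1) n).charmatrix := by
    ext1 i j
    simp [charmatrix_uht_neg_one_apply, Fin.one_succAbove_succ]
  rw [Matrix.det_succ_column_zero, Fin.sum_univ_succ, Finset.sum_eq_zero, Fin.succAbove_zero,
    hsub, Matrix.charpoly]
  · simp [uht_apply]
  · intro k _
    simp [uht_apply]

lemma charpoly_uht_neg_one_add_two (n : ℕ) :
    (uht (fun _ => -1) (n + 2)).charpoly =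
      (X + 2) * (uht (fun _ => -1) (n + 1)).charpoly - X * (uht (fun _ => -1) n).charpoly := by
  set A := (uht (fun _ => -1) (n + 2)).charmatrix with hA
  have hdet : (A.updateRow 0 (A 0 + (-1 : ℤ[X]) • A 1)).det = A.det :=
    Matrix.det_updateRow_add_smul_self A (by simp) (-1)
  have hsub (f : Fin (n + 1) → Fin (n + 2)) :
      (A.updateRow 0 (A 0 + (-1 : ℤ[X]) • A 1)).submatrix Fin.succ f =
        A.submatrix Fin.succ f := by
    ext1 i j
    simp [Matrix.updateRow_apply]
  rw [Matrix.charpoly, ← hA, ← hdet, Matrix.det_succ_row_zero, Fin.sum_univ_succ,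
    Fin.sum_univ_succ, Finset.sum_eq_zero]
  · simp only [hsub, Fin.succAbove_zero, Fin.succ_zero_eq_one]
    rw [hA, charmatrix_uht_neg_one_submatrix_succ,
      det_charmatrix_uht_neg_one_submatrix_succAbove_one, ← Matrix.charpoly]
    simp [uht_apply]
    ring
  · intro k _
    simp [hA, charmatrix_uht_neg_one_apply]

lemma charpoly_uht_neg_one_one : (uht (fun _ => -1) 1).charpoly = X + 1 := by
  simp [Matrix.charpoly, uht_apply]

lemma coeff_charpoly_uht_self (t : ℕ → ℤ) (n : ℕ) : (uht t n).charpoly.coeff n = 1 := by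
  simpa [Matrix.charpoly_natDegree_eq_dim] using (Matrix.charpoly_monic (uht t n)).coeff_natDegree

lemma one_sub_two_mul_X_mul_mk_coeff_zero :
    (1 - 2 * PowerSeries.X : PowerSeries ℤ) *
      PowerSeries.mk (fun ℓ => (uht (fun _ => -1) ℓ).charpoly.coeff 0) =
    1 - PowerSeries.X := by
  ext m
  rw [sub_mul, one_mul, mul_assoc, two_mul]
  rcases m with _ | _ | m
  · simp
  · simp [PowerSeries.coeff_succ_X_mul, charpoly_uht_neg_one_one]
  · simp [PowerSeries.coeff_succ_X_mul, charpoly_uht_neg_one_add_two, PowerSeries.coeff_X,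
      PowerSeries.coeff_one, mul_coeff_zero]
    ring

lemma one_sub_two_mul_X_mul_mk_coeff_succ (i : ℕ) :
    (1 - 2 * PowerSeries.X : PowerSeries ℤ) *
      PowerSeries.mk (fun ℓ => (uht (fun _ => -1) (i + 1 + ℓ)).charpoly.coeff (i + 1)) =
    (1 - PowerSeries.X) *
      PowerSeries.mk (fun ℓ => (uht (fun _ => -1) (i + ℓ)).charpoly.coeff i) := by
  ext m
  rw [sub_mul, sub_mul, one_mul, one_mul, mul_assoc, two_mul]
  rcases m with _ | m
  · simp [coeff_charpoly_uht_self]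
  · have h : (uht (fun _ => -1) (i + 1 + (m + 1))).charpoly.coeff (i + 1) =
        (uht (fun _ => -1) (i + (m + 1))).charpoly.coeff i +
          2 * (uht (fun _ => -1) (i + 1 + m)).charpoly.coeff (i + 1) -
          (uht (fun _ => -1) (i + m)).charpoly.coeff i := by
      rw [show i + 1 + (m + 1) = i + m + 2 by ring, charpoly_uht_neg_one_add_two,
        show i + (m + 1) = i + m + 1 by ring, show i + 1 + m = i + m + 1 by ring,
        add_mul, coeff_sub, coeff_add, coeff_X_mul, coeff_X_mul, coeff_ofNat_mul]
    simp only [map_sub, map_add, PowerSeries.coeff_succ_X_mul, PowerSeries.coeff_mk, h]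
    ring

/-- The generating function of the sequence `(p_{i,i}, p_{i+1,i}, p_{i+2,i}, …)` of
coefficients of `z^i` in the characteristic polynomials of `M̃_{i+ℓ} = uht (fun _ => -1) (i+ℓ)`
is `((1-X)/(1-2X))^(i+1)` in `ℤ⟦X⟧`. -/
theorem uht_neg_one_coeff_generating_function (i : ℕ) :
    (1 - 2 * PowerSeries.X : PowerSeries ℤ) ^ (i + 1) *
      PowerSeries.mk (fun ℓ => ((uht (fun _ => -1) (i + ℓ)).charpoly).coeff i) =
    (1 - PowerSeries.X : PowerSeries ℤ) ^ (i + 1) := by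
  induction i with
  | zero =>
    have h : (fun ℓ => (uht (fun _ => -1) (0 + ℓ)).charpoly.coeff 0) =
        fun ℓ => (uht (fun _ => -1) ℓ).charpoly.coeff 0 := by
      funext ℓ
      rw [zero_add]
    rw [h, zero_add, pow_one, pow_one, one_sub_two_mul_X_mul_mk_coeff_zero]
  | succ i ih =>
    rw [pow_succ, mul_assoc, one_sub_two_mul_X_mul_mk_coeff_succ, mul_left_comm, ih, ← pow_succ']
end

section
/- Let M̃_n = M_n(t₋) where t₋(k) = −1 for all k, and let P_n(z) be the characteristic polynomial of M̃_n. Then for every n ≥ 0 and every z ∈ ℂ, P_n(z) = Σ_{ℓ=0}^{⌊n/2⌋} C(n, 2ℓ) · (z/2 + 1)^{n−2ℓ} · (1 + z²/4)^{ℓ} + (z/2) · Σ_{ℓ=0}^{⌊(n−1)/2⌋} C(n, 2ℓ+1) · (z/2 + 1)^{n−2ℓ−1} · (1 + z²/4)^{ℓ}, where C(a,b) denotes the binomial coefficient. -/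
open Polynomial Matrix Finset

/-- The value at `z` of the characteristic matrix of `uht (fun _ => -1) n`. -/
def uhtNegOneCharmatrix {R : Type*} [CommRing R] (z : R) (n : ℕ) : Matrix (Fin n) (Fin n) R :=
  Matrix.of fun i j =>
    if (i : ℕ) = (j : ℕ) then z + 1
    else if (i : ℕ) < (j : ℕ) then 1
    else if (i : ℕ) = (j : ℕ) + 1 then -1 else 0

theorem aeval_charpoly_uht_neg_one {R : Type*} [CommRing R] (z : R) (n : ℕ) :
    Polynomial.aeval z (uht (fun _ => -1) n).charpoly = (uhtNegOneCharmatrix z n).det := by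
  rw [Polynomial.aeval_def, ← Polynomial.eval_map, ← Matrix.charpoly_map, Matrix.eval_charpoly]
  congr 1
  ext i j
  simp only [uht, uhtNegOneCharmatrix, Matrix.sub_apply, Matrix.scalar_apply, Matrix.map_apply,
    Matrix.of_apply, Matrix.diagonal_apply, Fin.ext_iff]
  split_ifs <;> first | omega | simp

theorem det_uhtNegOneCharmatrix_succ_succ {R : Type*} [CommRing R] (z : R) (n : ℕ) :
    (uhtNegOneCharmatrix z (n + 2)).det =
      (z + 2) * (uhtNegOneCharmatrix z (n + 1)).det - z * (uhtNegOneCharmatrix z n).det := by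
  set A := uhtNegOneCharmatrix z (n + 2)
  have hminor₀ : A.submatrix Fin.succ (Fin.succAbove 0) = uhtNegOneCharmatrix z (n + 1) := by
    ext i j
    simp [A, uhtNegOneCharmatrix]
  have hminor₁ : (A.submatrix Fin.succ (Fin.succAbove 1)).det =
      -(uhtNegOneCharmatrix z n).det := by
    rcases n with _ | n
    · simp [A, uhtNegOneCharmatrix, Fin.succAbove]
    rw [Matrix.det_succ_column_zero, Fin.sum_univ_succ, Finset.sum_eq_zero]
    · have hsub : (A.submatrix Fin.succ (Fin.succAbove 1)).submatrix (Fin.succAbove 0) Fin.succ =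
          uhtNegOneCharmatrix z (n + 1) := by
        ext i j
        simp [A, uhtNegOneCharmatrix]
      rw [hsub]
      simp [A, uhtNegOneCharmatrix, Fin.succAbove]
    · intro i _
      simp [A, uhtNegOneCharmatrix, Fin.succAbove]
  have hrow (v : Fin (n + 2) → R) (f : Fin (n + 1) → Fin (n + 2)) :
      (A.updateRow 0 v).submatrix Fin.succ f = A.submatrix Fin.succ f := by
    ext i j
    simp
  rw [← Matrix.det_updateRow_add_smul_self A (zero_ne_one : (0 : Fin (n + 2)) ≠ 1) (-1),
    Matrix.det_succ_row_zero, Fin.sum_univ_succ, Fin.sum_univ_succ, Finset.sum_eq_zero]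
  · simp only [hrow, hminor₀, Fin.succ_zero_eq_one, hminor₁, Matrix.updateRow_self]
    simp [A, uhtNegOneCharmatrix]
    ring
  · intro j _
    have hlt : (1 : Fin (n + 2)) < j.succ.succ := by
      rw [Fin.lt_def]
      simp
    simp [A, uhtNegOneCharmatrix, hlt]

theorem sum_choose_even_eq_of_le {R : Type*} [CommRing R] (a d : R) {n N : ℕ} (h : n / 2 + 1 ≤ N) :
    ∑ l ∈ Finset.range (n / 2 + 1), (n.choose (2 * l) : R) * a ^ (n - 2 * l) * d ^ l =
      ∑ l ∈ Finset.range N, (n.choose (2 * l) : R) * a ^ (n - 2 * l) * d ^ l := by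
  refine Finset.sum_subset (Finset.range_mono h) fun l _ hl => ?_
  rw [Finset.mem_range] at hl
  simp [Nat.choose_eq_zero_of_lt (show n < 2 * l by omega)]

theorem sum_choose_odd_eq_of_le {R : Type*} [CommRing R] (a d : R) {n N : ℕ}
    (h : (n - 1) / 2 + 1 ≤ N) :
    ∑ l ∈ Finset.range ((n - 1) / 2 + 1),
        (n.choose (2 * l + 1) : R) * a ^ (n - 2 * l - 1) * d ^ l =
      ∑ l ∈ Finset.range N, (n.choose (2 * l + 1) : R) * a ^ (n - 2 * l - 1) * d ^ l := by
  refine Finset.sum_subset (Finset.range_mono h) fun l _ hl => ?_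
  rw [Finset.mem_range] at hl
  simp [Nat.choose_eq_zero_of_lt (show n < 2 * l + 1 by omega)]

theorem choose_succ_mul_pow {R : Type*} [CommRing R] (a : R) (n k : ℕ) :
    ((n + 1).choose (k + 1) : R) * a ^ (n - k) =
      n.choose k * a ^ (n - k) + a * (n.choose (k + 1) * a ^ (n - k - 1)) := by
  rw [Nat.choose_succ_succ]
  rcases Nat.lt_or_ge k n with h | h
  · obtain ⟨m, rfl⟩ := Nat.exists_eq_add_of_lt h
    rw [show k + m + 1 - k = m + 1 by omega, Nat.add_sub_cancel]
    push_cast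
    ring
  · simp [Nat.choose_eq_zero_of_lt (show n < k + 1 by omega)]

theorem sum_choose_even_succ {R : Type*} [CommRing R] (a d : R) (n : ℕ) :
    ∑ l ∈ Finset.range ((n + 1) / 2 + 1),
        ((n + 1).choose (2 * l) : R) * a ^ (n + 1 - 2 * l) * d ^ l =
      a * ∑ l ∈ Finset.range (n / 2 + 1), (n.choose (2 * l) : R) * a ^ (n - 2 * l) * d ^ l +
      d * ∑ l ∈ Finset.range ((n - 1) / 2 + 1),
        (n.choose (2 * l + 1) : R) * a ^ (n - 2 * l - 1) * d ^ l := by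
  rw [sum_choose_even_eq_of_le a d (show (n + 1) / 2 + 1 ≤ n + 1 + 1 by omega),
    sum_choose_even_eq_of_le a d (show n / 2 + 1 ≤ n + 1 + 1 by omega),
    sum_choose_odd_eq_of_le a d (show (n - 1) / 2 + 1 ≤ n + 1 by omega),
    Finset.sum_range_succ', Finset.sum_range_succ' _ (n + 1), mul_add, Finset.mul_sum,
    Finset.mul_sum, add_right_comm, ← Finset.sum_add_distrib]
  congr 1
  · refine Finset.sum_congr rfl fun l _ => ?_
    have h := choose_succ_mul_pow a n (2 * l + 1)
    rw [show 2 * (l + 1) = 2 * l + 1 + 1 by ring, Nat.add_sub_add_right, h,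
      show n - 2 * l - 1 = n - (2 * l + 1) by omega,
      show n - (2 * l + 1 + 1) = n - (2 * l + 1) - 1 by omega]
    ring
  · simp [pow_succ']

theorem sum_choose_odd_succ {R : Type*} [CommRing R] (a d : R) (n : ℕ) :
    ∑ l ∈ Finset.range ((n + 1 - 1) / 2 + 1),
        ((n + 1).choose (2 * l + 1) : R) * a ^ (n + 1 - 2 * l - 1) * d ^ l =
      ∑ l ∈ Finset.range (n / 2 + 1), (n.choose (2 * l) : R) * a ^ (n - 2 * l) * d ^ l +
      a * ∑ l ∈ Finset.range ((n - 1) / 2 + 1),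
        (n.choose (2 * l + 1) : R) * a ^ (n - 2 * l - 1) * d ^ l := by
  rw [sum_choose_odd_eq_of_le a d (show (n - 1) / 2 + 1 ≤ n / 2 + 1 by omega),
    Finset.mul_sum, ← Finset.sum_add_distrib, Nat.add_sub_cancel]
  refine Finset.sum_congr rfl fun l _ => ?_
  have h := choose_succ_mul_pow a n (2 * l)
  rw [show n + 1 - 2 * l - 1 = n - 2 * l by omega, h]
  ring

theorem uht_neg_one_charpoly_explicit (n : ℕ) (z : ℂ) :
    (Polynomial.aeval z (uht (fun _ => -1) n).charpoly : ℂ) =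
      (∑ l ∈ Finset.range (n / 2 + 1),
        (n.choose (2 * l) : ℂ) * (z / 2 + 1) ^ (n - 2 * l) * (1 + z ^ 2 / 4) ^ l) +
      (z / 2) * ∑ l ∈ Finset.range ((n - 1) / 2 + 1),
        (n.choose (2 * l + 1) : ℂ) * (z / 2 + 1) ^ (n - 2 * l - 1) * (1 + z ^ 2 / 4) ^ l := by
  rw [aeval_charpoly_uht_neg_one]
  induction n using Nat.twoStepInduction with
  | zero => simp
  | one =>
    simp [uhtNegOneCharmatrix]
    ring
  | more n ih₀ ih₁ =>
    rw [det_uhtNegOneCharmatrix_succ_succ, ih₀, ih₁]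
    rw [sum_choose_even_succ _ _ (n + 1), sum_choose_odd_succ _ _ (n + 1),
      sum_choose_even_succ _ _ n, sum_choose_odd_succ _ _ n]
    ring
end
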